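/- For every integer m ≥ 2 there is no x ∈ ℝ such that q_m(x) = 0, q_{m+1}(x) = 0, and f^{(i)}(x) ∉ {2, 5} for every integer 0 ≤ i ≤ m−1. -/

import Mathlib

open Function

noncomputable section

/-- The polynomial map `f(x) = x(5-x)`. -/
def f (x : ℝ) : ℝ := x * (5 - x)

/-- `l(x) = x - 6`. -/
def lf (x : ℝ) : ℝ := x - 6

/-- `s(x) = (2-x)(4-x)(5-x) - (14-3x)`. -/
def sf (x : ℝ) : ℝ := (2 - x) * (4 - x) * (5 - x) - (14 - 3 * x)

/-- `r(x) = -2(2-x)(5-x)`. -/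
def rf (x : ℝ) : ℝ := -2 * (2 - x) * (5 - x)

/-- The decreasing inverse branch of `f`. -/
def phim (x : ℝ) : ℝ := (5 - Real.sqrt (25 - 4 * x)) / 2

/-- The increasing inverse branch of `f`. -/
def phip (x : ℝ) : ℝ := (5 + Real.sqrt (25 - 4 * x)) / 2

/-- `q m` is the function `q_m` from the paper, meaningful for `m ≥ 2`
(the values at `m = 0, 1` are junk values `1`, never used in the statements). -/
def q : ℕ → ℝ → ℝ
  | 0, _ => 1
  | 1, _ => 1
  | 2, x => sf x
  | 3, x => sf (f x) * sf x - rf (f x) * lf x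
  | m + 4, x =>
      sf (f^[m + 2] x) * q (m + 3) x - rf (f^[m + 2] x) * lf (f^[m + 1] x) * q (m + 2) x

open Polynomial in
/-- The integer polynomial inducing the `n`-fold iterate of `f`. -/
def iterPoly : ℕ → ℤ[X]
  | 0 => X
  | n + 1 => (iterPoly n).comp (X * (5 - X))

open Polynomial in
/-- The integer polynomial inducing `q (m + 1)`. -/
def qPoly : ℕ → ℤ[X]
  | 0 => 1
  | 1 => (2 - X) * (4 - X) * (5 - X) - (14 - 3 * X)
  | m + 2 =>
      ((2 - X) * (4 - X) * (5 - X) - (14 - 3 * X) : ℤ[X]).comp (iterPoly (m + 1)) * qPoly (m + 1)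
        - (-2 * (2 - X) * (5 - X) : ℤ[X]).comp (iterPoly (m + 1))
          * (X - 6 : ℤ[X]).comp (iterPoly m) * qPoly m

open Polynomial in
theorem aeval_iterPoly (n : ℕ) (x : ℝ) : aeval x (iterPoly n) = f^[n] x := by
  induction n generalizing x with
  | zero => simp [iterPoly]
  | succ n ih => simp [iterPoly, aeval_comp, ih, f, map_ofNat]

open Polynomial in
theorem eval_zero_iterPoly (n : ℕ) : (iterPoly n).eval 0 = 0 := by
  induction n with
  | zero => simp [iterPoly]
  | succ n ih => simp [iterPoly, eval_comp, ih]

theorem q_add_three (m : ℕ) (x : ℝ) :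
    q (m + 3) x = sf (f^[m + 1] x) * q (m + 2) x
      - rf (f^[m + 1] x) * lf (f^[m] x) * q (m + 1) x := by
  cases m <;> simp [q]

open Polynomial in
theorem aeval_qPoly (m : ℕ) (x : ℝ) : aeval x (qPoly m) = q (m + 1) x := by
  induction m using Nat.twoStepInduction with
  | zero => simp [qPoly, q]
  | one => simp [qPoly, q, sf, map_ofNat]
  | more m ih ih' =>
    rw [q_add_three, ← ih, ← ih']
    simp [qPoly, aeval_iterPoly, sf, rf, lf, map_ofNat]

open Polynomial in
theorem not_three_dvd_eval_zero_qPoly (m : ℕ) : ¬ (3 : ℤ) ∣ (qPoly m).eval 0 := by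
  induction m using Nat.twoStepInduction with
  | zero => simp [qPoly]
  | one => norm_num [qPoly]
  | more m ih ih' =>
    simp only [qPoly, eval_sub, eval_mul, eval_comp, eval_zero_iterPoly, eval_X, eval_ofNat,
      eval_neg]
    omega

open Polynomial in
/-- `ℤ[X]` is generated by `1` and `X` over the subring of polynomials in `X * (5 - X)`. -/
theorem exists_eq_comp_add_X_mul_comp (p : ℤ[X]) :
    ∃ a b : ℤ[X], p = a.comp (X * (5 - X)) + X * b.comp (X * (5 - X)) := by
  induction p using Polynomial.induction_on with
  | C c => exact ⟨C c, 0, by simp⟩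
  | add p r hp hr =>
    obtain ⟨a, b, hab⟩ := hp
    obtain ⟨c, d, hcd⟩ := hr
    refine ⟨a + c, b + d, ?_⟩
    rw [add_comp, add_comp, hab, hcd]
    ring
  | monomial n c h =>
    obtain ⟨a, b, hab⟩ := h
    refine ⟨-(X * b), a + 5 * b, ?_⟩
    rw [pow_succ, ← mul_assoc, hab]
    simp only [neg_comp, mul_comp, add_comp, X_comp, ofNat_comp]
    ring

open Polynomial in
/-- The norm of `p` over the subring of polynomials in `X * (5 - X)` lies in that subring. -/
theorem exists_comp_eq_mul_comp (p : ℤ[X]) :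
    ∃ s : ℤ[X], s.comp (X * (5 - X)) = p * p.comp (5 - X) := by
  obtain ⟨a, b, hab⟩ := exists_eq_comp_add_X_mul_comp p
  have hF (r : ℤ[X]) : (r.comp (X * (5 - X))).comp (5 - X) = r.comp (X * (5 - X)) := by
    rw [Polynomial.comp_assoc]
    congr 1
    simp only [mul_comp, sub_comp, X_comp, ofNat_comp]
    ring
  refine ⟨a ^ 2 + 5 * a * b + X * b ^ 2, ?_⟩
  conv_rhs => rw [hab]
  simp only [add_comp, mul_comp, pow_comp, X_comp, ofNat_comp, hF]
  push_cast
  ring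

theorem isIntegral_of_isIntegral_f {x : ℝ} (h : IsIntegral ℤ (f x)) : IsIntegral ℤ x := by
  have hm : (Polynomial.X * (Polynomial.X - Polynomial.C 5) : Polynomial ℤ).Monic :=
    Polynomial.monic_X.mul (Polynomial.monic_X_sub_C 5)
  refine IsIntegral.of_aeval_monic hm ?_ ?_
  · rw [Polynomial.monic_X.natDegree_mul (Polynomial.monic_X_sub_C 5)]
    simp
  · have : Polynomial.aeval x
        (Polynomial.X * (Polynomial.X - Polynomial.C 5) : Polynomial ℤ) = -f x := by
      simp [f, map_ofNat]
      ring
    rw [this]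
    exact h.neg

theorem isIntegral_of_iterate_eq_three {n : ℕ} {x : ℝ} (h : f^[n] x = 3) : IsIntegral ℤ x := by
  induction n generalizing x with
  | zero =>
    rw [iterate_zero_apply] at h
    rw [h]
    exact_mod_cast isIntegral_algebraMap (R := ℤ) (A := ℝ) (x := 3)
  | succ n ih => exact isIntegral_of_isIntegral_f (ih (by rwa [iterate_succ_apply] at h))

open Polynomial in
theorem iterPoly_sub_three_dvd (n : ℕ) (x : ℝ) (hx : f^[n] x = 3) (p : ℤ[X])
    (hp : aeval x p = 0) : iterPoly n - 3 ∣ p := by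
  induction n generalizing x p with
  | zero =>
    rw [iterate_zero_apply] at hx
    subst hx
    have h3 : p.IsRoot 3 := by
      have : aeval (algebraMap ℤ ℝ 3) p = 0 := by simpa using hp
      rw [aeval_algebraMap_apply] at this
      simpa using this
    simpa [iterPoly] using dvd_iff_isRoot.mpr h3
  | succ n ih =>
    have hint : IsIntegral ℤ x := isIntegral_of_iterate_eq_three hx
    set h := minpoly ℤ x with h_def
    have hirr : Irreducible h := (minpoly.prime_of_isIntegrallyClosed hint).irreducible
    have hh : aeval x h = 0 := minpoly.aeval ℤ x
    obtain ⟨k, hk⟩ : h ∣ iterPoly (n + 1) - 3 := by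
      refine minpoly.isIntegrallyClosed_dvd hint ?_
      rw [map_sub, aeval_iterPoly, hx, map_ofNat, sub_self]
    have hinv (r : ℤ[X]) : (r.comp (5 - X)).comp (5 - X) = r := by
      rw [Polynomial.comp_assoc]
      simp
    obtain ⟨s, hs⟩ := exists_comp_eq_mul_comp h
    have hs0 : aeval (f x) s = 0 := by
      have := congrArg (aeval x) hs
      simpa [aeval_comp, hh, f, map_ofNat] using this
    obtain ⟨t, ht⟩ := ih (f x) (by rwa [iterate_succ_apply] at hx) s hs0
    have hkt : h.comp (5 - X) = k * t.comp (X * (5 - X)) := by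
      refine mul_left_cancel₀ hirr.ne_zero ?_
      rw [← hs, ht, mul_comp, ← mul_assoc, ← hk]
      simp [iterPoly]
    have hfac : h = k.comp (5 - X) * (t.comp (X * (5 - X))).comp (5 - X) := by
      rw [← mul_comp, ← hkt, hinv]
    have hunit {r : ℤ[X]} (hr : IsUnit (r.comp (5 - X))) : IsUnit r := by
      have := hr.map (compRingHom (5 - X : ℤ[X]))
      rwa [coe_compRingHom_apply, hinv] at this
    rcases hirr.isUnit_or_isUnit hfac with hu | hu
    · rw [hk, (hunit hu).mul_right_dvd]
      exact minpoly.isIntegrallyClosed_dvd hint hp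
    · exfalso
      have he := (hunit hu).map (evalRingHom (0 : ℤ))
      have h1 := congrArg (Polynomial.eval 0) hk
      have h2 := congrArg (Polynomial.eval 0) hkt
      rw [coe_evalRingHom] at he
      rw [eval_sub, eval_zero_iterPoly, eval_mul, eval_ofNat] at h1
      rw [eval_mul, eval_comp] at h2
      simp only [eval_sub, eval_X, eval_ofNat, sub_zero] at h2
      obtain ⟨c, hc⟩ := sub_dvd_eval_sub (5 : ℤ) 0 h
      have h5 : h.eval 5 = h.eval 0 + 5 * c := by linarith
      have key : h.eval 0 * h.eval 0 + 5 * (c * h.eval 0) =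
          -3 * (t.comp (X * (5 - X))).eval 0 := by
        rw [h5] at h2
        linear_combination (h.eval 0) * h2 - (t.comp (X * (5 - X))).eval 0 * h1
      have hmod : h.eval 0 * h.eval 0 % 5 = 0 ∨ h.eval 0 * h.eval 0 % 5 = 1 ∨
          h.eval 0 * h.eval 0 % 5 = 4 := by
        have : h.eval 0 % 5 = 0 ∨ h.eval 0 % 5 = 1 ∨ h.eval 0 % 5 = 2 ∨ h.eval 0 % 5 = 3 ∨
          h.eval 0 % 5 = 4 := by omega
        rcases this with h | h | h | h | h <;> simp [Int.mul_emod, h]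
      rcases Int.isUnit_iff.mp he with he | he <;> rw [he] at key <;> omega

theorem q_ne_zero_of_iterate_eq_three {n : ℕ} {x : ℝ} (hx : f^[n] x = 3) (m : ℕ) :
    q (m + 1) x ≠ 0 := by
  intro hq
  rw [← aeval_qPoly] at hq
  have h := Polynomial.eval_dvd (x := 0) (iterPoly_sub_three_dvd n x hx _ hq)
  rw [Polynomial.eval_sub, eval_zero_iterPoly, Polynomial.eval_ofNat, zero_sub, neg_dvd] at h
  exact not_three_dvd_eval_zero_qPoly m h

theorem eq_two_or_eq_three_of_f_eq_six {y : ℝ} (h : f y = 6) : y = 2 ∨ y = 3 := by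
  have : (y - 2) * (y - 3) = 0 := by
    unfold f at h
    linarith
  rcases mul_eq_zero.mp this with h | h
  · exact Or.inl (by linarith)
  · exact Or.inr (by linarith)

theorem rf_ne_zero {y : ℝ} (h2 : y ≠ 2) (h5 : y ≠ 5) : rf y ≠ 0 :=
  mul_ne_zero (mul_ne_zero (by norm_num) (sub_ne_zero.mpr h2.symm)) (sub_ne_zero.mpr h5.symm)

theorem statement_11 (m : ℕ) (hm : 2 ≤ m) :
    ¬ ∃ x : ℝ, q m x = 0 ∧ q (m + 1) x = 0 ∧
      ∀ i : ℕ, i ≤ m - 1 → f^[i] x ≠ 2 ∧ f^[i] x ≠ 5 := by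
  rintro ⟨x, hq, hq', hi⟩
  obtain ⟨m, rfl⟩ := Nat.exists_eq_add_of_le' hm
  clear hm
  induction m with
  | zero =>
    have h1 := hi 1 (by norm_num)
    rw [q_add_three, hq, mul_zero, zero_sub, neg_eq_zero] at hq'
    simp only [q, mul_one, zero_add, iterate_zero_apply] at hq hq'
    have hl := (mul_eq_zero.mp hq').resolve_left (rf_ne_zero h1.1 h1.2)
    have hx : x = 6 := sub_eq_zero.mp hl
    norm_num [hx, sf] at hq
  | succ m ih =>
    have h1 := hi (m + 2) (by omega)
    rw [show m + 1 + 2 + 1 = m + 1 + 3 by ring, q_add_three, hq, mul_zero, zero_sub,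
      neg_eq_zero] at hq'
    rcases mul_eq_zero.mp hq' with h | h
    · have hl := (mul_eq_zero.mp h).resolve_left (rf_ne_zero h1.1 h1.2)
      have h6 : f (f^[m] x) = 6 := by
        rw [← iterate_succ_apply' f]
        exact sub_eq_zero.mp hl
      rcases eq_two_or_eq_three_of_f_eq_six h6 with h2 | h3
      · exact (hi m (by omega)).1 h2
      · exact q_ne_zero_of_iterate_eq_three h3 (m + 2) hq
    · exact ih h hq fun i hi' => hi i (by omega)
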